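/- Let q be a prime power, F a finite field with q elements, and m ≥ 2. Let H₂ᵀ be the matrix over ZMod 2 whose rows are indexed by all points of F^m and whose columns are indexed by all lines of EG(m,q), with entry 1 iff the point lies on the line. If q is odd and m is even, then M = [ H₂ᵀ | 𝟙 | I ], obtained by appending an all-ones column and a q^m × q^m identity matrix, is self-orthogonal: M · Mᵀ = 0 over ZMod 2. -/

import Mathlib

open Matrix

/-- A line of the Euclidean geometry `EG(m,q)`: a coset `a + F·b` of a one-dimensional
linear subspace of `F^m`, realized as a `Finset` of points. -/
def IsLine (F : Type*) [Field F] [Fintype F] [DecidableEq F] (m : ℕ)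
    (L : Finset (Fin m → F)) : Prop :=
  ∃ a b : Fin m → F, b ≠ 0 ∧ L = Finset.univ.image (fun t : F => a + t • b)

noncomputable instance (F : Type*) [Field F] [Fintype F] [DecidableEq F] (m : ℕ) :
    Fintype {L : Finset (Fin m → F) // IsLine F m L} :=
  Fintype.ofFinite _

/-- The matrix `M = [ H₂ᵀ | 𝟙 | I ]` over `ZMod 2`: rows indexed by all points of `F^m`,
columns indexed by all lines of `EG(m,q)`, together with one all-ones column and the
columns of a `q^m × q^m` identity matrix. -/
def M2 (F : Type*) [Field F] [Fintype F] [DecidableEq F] (m : ℕ) :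
    Matrix (Fin m → F)
      ({L : Finset (Fin m → F) // IsLine F m L} ⊕ (Unit ⊕ (Fin m → F))) (ZMod 2) :=
  Matrix.of fun p c =>
    Sum.elim (fun L => if p ∈ L.1 then 1 else 0)
      (Sum.elim (fun _ => 1) (fun w => if p = w then 1 else 0)) c

section Lines

variable {F : Type*} [Field F] [Fintype F] [DecidableEq F] {m : ℕ}

lemma IsLine.card_eq {L : Finset (Fin m → F)} (hL : IsLine F m L) :
    L.card = Fintype.card F := by
  obtain ⟨a, b, hb, rfl⟩ := hL
  rw [Finset.card_image_of_injective _ fun s t h => smul_left_injective F hb (add_left_cancel h),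
    Finset.card_univ]

lemma IsLine.eq_image {L : Finset (Fin m → F)} (hL : IsLine F m L) {p r : Fin m → F}
    (hpr : p ≠ r) (hp : p ∈ L) (hr : r ∈ L) :
    L = Finset.univ.image (fun t : F => p + t • (r - p)) := by
  have hinj : Function.Injective fun t : F => p + t • (r - p) := fun s t h =>
    smul_left_injective F (sub_ne_zero.2 hpr.symm) (add_left_cancel h)
  refine (Finset.eq_of_subset_of_card_le ?_ ?_).symm
  · obtain ⟨a, b, -, rfl⟩ := hL
    simp only [Finset.mem_image, Finset.mem_univ, true_and] at hp hr
    obtain ⟨s, rfl⟩ := hp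
    obtain ⟨u, rfl⟩ := hr
    simp only [Finset.subset_iff, Finset.mem_image, Finset.mem_univ, true_and]
    rintro _ ⟨t, rfl⟩
    exact ⟨s + t * (u - s), by module⟩
  · rw [hL.card_eq, Finset.card_image_of_injective _ hinj, Finset.card_univ]

/-- Exactly one line passes through two distinct points. -/
lemma card_lines_through_pair {p r : Fin m → F} (hpr : p ≠ r) :
    (Finset.univ.filter fun L : {L : Finset (Fin m → F) // IsLine F m L} =>
      p ∈ L.1 ∧ r ∈ L.1).card = 1 := by
  rw [Finset.card_eq_one]
  refine ⟨⟨_, p, r - p, sub_ne_zero.2 hpr.symm, rfl⟩, ?_⟩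
  ext L
  simp only [Finset.mem_filter, Finset.mem_univ, true_and, Finset.mem_singleton]
  refine ⟨fun h => Subtype.ext (L.2.eq_image hpr h.1 h.2), ?_⟩
  rintro rfl
  simp only [Finset.mem_image, Finset.mem_univ, true_and]
  exact ⟨⟨0, by module⟩, ⟨1, by module⟩⟩

/-- The number of lines through a point is `1 + q + ⋯ + q ^ (m - 1)`. -/
lemma card_lines_through_point (p : Fin m → F) :
    (Finset.univ.filter fun L : {L : Finset (Fin m → F) // IsLine F m L} => p ∈ L.1).card =
      ∑ i ∈ Finset.range m, Fintype.card F ^ i := by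
  have hq : 1 < Fintype.card F := Fintype.one_lt_card
  have h := Finset.sum_card_bipartiteAbove_eq_sum_card_bipartiteBelow
    (s := Finset.univ.filter fun L : {L : Finset (Fin m → F) // IsLine F m L} => p ∈ L.1)
    (t := Finset.univ.erase p) (fun L r => r ∈ L.1)
  rw [Finset.sum_congr rfl (g := fun _ => Fintype.card F - 1),
    Finset.sum_congr (s₁ := Finset.univ.erase p) rfl (g := fun _ => 1)] at h
  · simp only [Finset.sum_const, smul_eq_mul, mul_one, Finset.card_erase_of_mem (Finset.mem_univ p),
      Finset.card_univ, Fintype.card_fun, Fintype.card_fin] at h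
    rw [Nat.geomSum_eq hq, ← h, Nat.mul_div_cancel _ (Nat.sub_pos_of_lt hq)]
  · intro r hr
    rw [Finset.bipartiteBelow, Finset.filter_filter]
    exact card_lines_through_pair (Finset.ne_of_mem_erase hr).symm
  · intro L hL
    rw [← L.2.card_eq, ← Finset.card_erase_of_mem (Finset.mem_filter.1 hL).2]
    congr 1
    ext r
    simp [Finset.mem_bipartiteAbove]

end Lines

theorem stmt_2 (q : ℕ) (hq : IsPrimePow q) (F : Type*) [Field F] [Fintype F] [DecidableEq F]
    (hcard : Fintype.card F = q) (m : ℕ) (hm : 2 ≤ m)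
    (hqodd : Odd q) (hmeven : Even m) :
    M2 F m * (M2 F m)ᵀ = 0 := by
  ext p r
  have hlines : (M2 F m * (M2 F m)ᵀ) p r =
      ((Finset.univ.filter fun L : {L : Finset (Fin m → F) // IsLine F m L} =>
        p ∈ L.1 ∧ r ∈ L.1).card : ZMod 2) + (1 + if p = r then 1 else 0) := by
    simp only [Matrix.mul_apply, Matrix.transpose_apply, M2, Matrix.of_apply, Fintype.sum_sum_type,
      Sum.elim_inl, Sum.elim_inr, Finset.card_filter, Nat.cast_sum, ite_and]
    congr 1
    · refine Finset.sum_congr rfl fun L _ => ?_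
      split_ifs <;> simp
    · simp
  rw [hlines, Matrix.zero_apply]
  by_cases hpr : p = r
  · subst hpr
    obtain ⟨k, rfl⟩ := hmeven
    have hq1 : ((Fintype.card F : ℕ) : ZMod 2) = 1 := by
      rw [hcard]
      exact (ZMod.natCast_eq_one_iff_odd).2 hqodd
    simp only [and_self, if_true, card_lines_through_point, Nat.cast_sum, Nat.cast_pow, hq1,
      one_pow, Finset.sum_const, Finset.card_range, nsmul_eq_mul, mul_one, Nat.cast_add,
      CharTwo.add_self_eq_zero]
  · rw [card_lines_through_pair hpr, if_neg hpr, Nat.cast_one, add_zero,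
      CharTwo.add_self_eq_zero]
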